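/- arXiv:2107.14393 — 2 statements merged into one kernel-verified Lean document; each statement's English description precedes it below -/
import Mathlib

section
/- Let U be a bounded connected open set in ℂⁿ and f : U → U holomorphic with f(U) contained in a compact subset of U, with fixed point z₀. If for every k ≥ 1 the induced map f_* : π_k(U, z₀) → π_k(U, z₀) is an isomorphism, then π_k(U, z₀) = 0 for all k ≥ 1. -/
open Topology Topology.Homotopy

/-- The map induced by a continuous map `f : X → Y` on homotopy groups,
`f_* : π(N, X, x) → π(N, Y, f x)`. -/
noncomputable def inducedPi {X Y : Type*} [TopologicalSpace X] [TopologicalSpace Y]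
    (f : C(X, Y)) (N : Type*) (x : X) :
    HomotopyGroup N X x → HomotopyGroup N Y (f x) :=
  Quotient.map
    (fun g => ⟨f.comp g.1, fun y hy => by
      simp only [ContinuousMap.comp_apply]
      rw [g.2 y hy]⟩)
    (fun g h H => H.map fun Hgh => Hgh.compContinuousMap f)

section EarleHamilton

open Metric Set Function Filter

variable {E : Type*} [NormedAddCommGroup E] [NormedSpace ℂ E] {U K : Set E} {f : E → E}

/-- The derivatives of the iterates of a holomorphic map `f : U → U`, even when followed by another
holomorphic self-map of `U`, decay geometrically as soon as `f` can be perturbed to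
`z ↦ f z + δ • (f z - f y)` without leaving `U`. -/
theorem norm_fderiv_comp_iterate_le (hUo : IsOpen U) (hUb : Bornology.IsBounded U)
    (hf : DifferentiableOn ℂ f U) (hmaps : MapsTo f U U) {δ : ℝ} (hδ : 0 < δ)
    (hpert : ∀ y ∈ U, MapsTo (fun z => f z + (δ : ℂ) • (f z - f y)) U U)
    {x : E} {r : ℝ} (hr : 0 < r) (hxr : ball x r ⊆ U) (n : ℕ) {h : E → E}
    (hh : DifferentiableOn ℂ h U) (hhm : MapsTo h U U) :
    ‖fderiv ℂ (h ∘ f^[n]) x‖ ≤ diam U / r * (1 + δ)⁻¹ ^ n := by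
  have hxU : x ∈ U := hxr (mem_ball_self hr)
  induction n generalizing h with
  | zero =>
    have := Complex.norm_fderiv_le_div_of_mapsTo_ball (hh.mono hxr)
      (fun z hz => mem_closedBall.2 (dist_le_diam_of_mem hUb (hhm (hxr hz)) (hhm hxU))) hr
    simpa using this
  | succ n ih =>
    set y := f^[n] x
    have hyU : y ∈ U := hmaps.iterate n hxU
    set g : E → E := fun z => f z + (δ : ℂ) • (f z - f y) with hg
    have hgd : DifferentiableOn ℂ g U := hf.add ((hf.sub_const _).const_smul _)
    have hfn : DifferentiableAt ℂ f^[n] x :=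
      (hf.iterate hmaps n).differentiableAt (hUo.mem_nhds hxU)
    have hfy : HasFDerivAt f (fderiv ℂ f y) y :=
      (hf.differentiableAt (hUo.mem_nhds hyU)).hasFDerivAt
    have hgy : HasFDerivAt g (fderiv ℂ f y + (δ : ℂ) • fderiv ℂ f y) y :=
      hfy.add ((hfy.sub_const _).const_smul _)
    have hgyy : g y = f y := by simp [hg]
    have hhy : HasFDerivAt h (fderiv ℂ h (f y)) (f y) :=
      (hh.differentiableAt (hUo.mem_nhds (hmaps hyU))).hasFDerivAt
    have h₁ : HasFDerivAt (h ∘ f^[n + 1])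
        ((fderiv ℂ h (f y)).comp ((fderiv ℂ f y).comp (fderiv ℂ f^[n] x))) x := by
      rw [iterate_succ']
      exact HasFDerivAt.comp x hhy (HasFDerivAt.comp x hfy hfn.hasFDerivAt)
    have h₂ : HasFDerivAt ((h ∘ g) ∘ f^[n])
        ((fderiv ℂ h (f y)).comp ((fderiv ℂ f y + (δ : ℂ) • fderiv ℂ f y).comp
          (fderiv ℂ f^[n] x))) x := by
      rw [← hgyy] at hhy ⊢
      exact (HasFDerivAt.comp y hhy hgy).comp x hfn.hasFDerivAt
    have key := ih (hh.comp hgd (hpert y hyU)) (hhm.comp (hpert y hyU))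
    have heq : fderiv ℂ ((h ∘ g) ∘ f^[n]) x =
        ((1 + δ : ℝ) : ℂ) • fderiv ℂ (h ∘ f^[n + 1]) x := by
      rw [h₁.fderiv, h₂.fderiv]
      ext v
      simp [add_smul]
    rw [heq, norm_smul, Complex.norm_real, Real.norm_of_nonneg (by positivity)] at key
    rw [pow_succ, ← mul_assoc, ← div_eq_mul_inv _ (1 + δ), le_div_iff₀ (by positivity), mul_comm]
    exact key

/-- A holomorphic self-map of a bounded open set whose image lies in a compact subset `K` of `U`
admits the perturbations required by `norm_fderiv_comp_iterate_le`. -/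
theorem exists_mapsTo_add_smul_sub (hUo : IsOpen U) (hUb : Bornology.IsBounded U)
    (hmaps : MapsTo f U U) (hK : IsCompact K) (hKU : K ⊆ U) (hfK : f '' U ⊆ K) :
    ∃ δ : ℝ, 0 < δ ∧ ∀ y ∈ U, MapsTo (fun z => f z + (δ : ℂ) • (f z - f y)) U U := by
  obtain ⟨ε, hε, hεU⟩ := hK.exists_thickening_subset_open hUo hKU
  have hd : 0 ≤ diam U := diam_nonneg
  refine ⟨ε / (diam U + 1), by positivity, fun y hy z hz => hεU ?_⟩
  refine mem_thickening_iff.2 ⟨f z, hfK (mem_image_of_mem f hz), ?_⟩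
  rw [dist_eq_norm, add_sub_cancel_left, norm_smul, Complex.norm_real,
    Real.norm_of_nonneg (by positivity), ← dist_eq_norm, div_mul_eq_mul_div,
    div_lt_iff₀ (by positivity)]
  have := dist_le_diam_of_mem hUb (hmaps hz) (hmaps hy)
  gcongr
  linarith

/-- **Earle–Hamilton**: the iterates of a holomorphic self-map of a bounded connected open set `U`
whose image lies in a compact subset of `U` converge locally uniformly to the fixed point. -/
theorem tendstoLocallyUniformlyOn_iterate (hUo : IsOpen U) (hUc : IsPreconnected U)
    (hUb : Bornology.IsBounded U) (hf : DifferentiableOn ℂ f U) (hmaps : MapsTo f U U)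
    (hK : IsCompact K) (hKU : K ⊆ U) (hfK : f '' U ⊆ K) {x₀ : E} (hx₀ : x₀ ∈ U)
    (hfix : IsFixedPt f x₀) :
    TendstoLocallyUniformlyOn (fun n => f^[n]) (fun _ => x₀) atTop U := by
  obtain ⟨δ, hδ, hpert⟩ := exists_mapsTo_add_smul_sub hUo hUb hmaps hK hKU hfK
  have hlip : ∀ x ∈ U, ∃ r > 0, ball x r ⊆ U ∧ ∃ u : ℕ → ℝ, Tendsto u atTop (𝓝 0) ∧
      ∀ y ∈ ball x r, ∀ z ∈ ball x r, ∀ n, dist (f^[n] y) (f^[n] z) ≤ u n := by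
    intro x hx
    obtain ⟨s, hs, hsU⟩ := Metric.isOpen_iff.1 hUo x hx
    have hs2 : 0 < s / 2 := half_pos hs
    have hsub : ball x (s / 2) ⊆ U := (ball_subset_ball (by linarith)).trans hsU
    refine ⟨s / 2, hs2, hsub, fun n => diam U / (s / 2) * (1 + δ)⁻¹ ^ n * s, ?_, ?_⟩
    · have := tendsto_pow_atTop_nhds_zero_of_lt_one (r := (1 + δ)⁻¹) (by positivity)
        (inv_lt_one_of_one_lt₀ (by linarith))
      simpa using (this.const_mul (diam U / (s / 2))).mul_const s
    · intro y hy z hz n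
      let : NormedSpace ℝ E := NormedSpace.restrictScalars ℝ ℂ E
      have hb : ∀ w ∈ ball x (s / 2), ‖fderiv ℂ f^[n] w‖ ≤
          diam U / (s / 2) * (1 + δ)⁻¹ ^ n := fun w hw =>
        norm_fderiv_comp_iterate_le hUo hUb hf hmaps hδ hpert hs2
          ((ball_subset_ball' (by rw [mem_ball] at hw; linarith)).trans hsU) n
          differentiableOn_id (mapsTo_id U)
      have := (convex_ball x (s / 2)).norm_image_sub_le_of_norm_fderiv_le
        (fun w hw => (hf.iterate hmaps n).differentiableAt (hUo.mem_nhds (hsub hw))) hb hz hy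
      rw [← dist_eq_norm, ← dist_eq_norm] at this
      refine this.trans ?_
      have hd : 0 ≤ diam U := diam_nonneg
      dsimp only
      gcongr
      rw [mem_ball] at hy hz
      linarith [dist_triangle_right y z x]
  have hprop : ∀ x ∈ U, ∃ r > 0, ball x r ⊆ U ∧
      ((∃ y ∈ ball x r, Tendsto (fun n => f^[n] y) atTop (𝓝 x₀)) →
        TendstoUniformlyOn (fun n => f^[n]) (fun _ => x₀) atTop (ball x r)) := by
    intro x hx
    obtain ⟨r, hr, hrU, u, hu, hle⟩ := hlip x hx
    refine ⟨r, hr, hrU, fun ⟨y, hy, hyt⟩ => Metric.tendstoUniformlyOn_iff.2 fun ε hε => ?_⟩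
    filter_upwards [hu.eventually (gt_mem_nhds (half_pos hε)),
      Metric.tendsto_nhds.1 hyt (ε / 2) (half_pos hε)] with n hn₁ hn₂ z hz
    linarith [dist_triangle_left x₀ (f^[n] z) (f^[n] y), hle y hy z hz n]
  set A : Set E := {x | x ∈ U ∧ Tendsto (fun n => f^[n] x) atTop (𝓝 x₀)}
  have hUA : U ⊆ A := by
    refine hUc.subset_of_closure_inter_subset (Metric.isOpen_iff.2 ?_) ⟨x₀, hx₀, hx₀, ?_⟩ ?_
    · rintro x ⟨hx, hxt⟩
      obtain ⟨r, hr, hrU, h⟩ := hprop x hx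
      exact ⟨r, hr, fun z hz => ⟨hrU hz, (h ⟨x, mem_ball_self hr, hxt⟩).tendsto_at hz⟩⟩
    · simp only [iterate_fixed hfix, tendsto_const_nhds]
    · rintro x ⟨hxA, hx⟩
      obtain ⟨r, hr, hrU, h⟩ := hprop x hx
      obtain ⟨y, hy, hyx⟩ := Metric.mem_closure_iff.1 hxA r hr
      exact ⟨hx, (h ⟨y, mem_ball'.2 hyx, hy.2⟩).tendsto_at (mem_ball_self hr)⟩
  refine tendstoLocallyUniformlyOn_of_forall_exists_nhds fun x hx => ?_
  obtain ⟨r, hr, hrU, h⟩ := hprop x hx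
  exact ⟨ball x r, mem_nhdsWithin_of_mem_nhds (ball_mem_nhds x hr),
    h ⟨x, mem_ball_self hr, (hUA hx).2⟩⟩

end EarleHamilton

section Homotopy

open scoped unitInterval

/-- Two continuous maps into `U` that agree on `S` and take their values in a convex subset of `U`
are homotopic relative to `S`. -/
theorem ContinuousMap.homotopicRel_of_convex {X E : Type*} [TopologicalSpace X]
    [AddCommGroup E] [Module ℝ E] [TopologicalSpace E] [ContinuousAdd E] [ContinuousSMul ℝ E]
    {U B : Set E} (hB : Convex ℝ B) (hBU : B ⊆ U) {S : Set X} (g₀ g₁ : C(X, U))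
    (h₀ : ∀ x, (g₀ x : E) ∈ B) (h₁ : ∀ x, (g₁ x : E) ∈ B) (hS : ∀ x ∈ S, g₀ x = g₁ x) :
    g₀.HomotopicRel g₁ S := by
  refine ⟨⟨⟨⟨fun p => ⟨(1 - (p.1 : ℝ)) • (g₀ p.2 : E) + (p.1 : ℝ) • (g₁ p.2 : E),
    hBU (hB (h₀ p.2) (h₁ p.2) (sub_nonneg.2 p.1.2.2) p.1.2.1 (by ring))⟩,
    by fun_prop⟩, fun x => by simp, fun x => by simp⟩, fun t x hx => ?_⟩⟩
  simp [← hS x hx, ← add_smul]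

/-- If `F` fixes `x` and is injective on `π(N, X, x)`, then a loop whose image under some iterate
of `F` is null-homotopic is null-homotopic. -/
theorem homotopicRel_const_of_iterate {X N : Type*} [TopologicalSpace X] {F : C(X, X)} {x : X}
    (hFx : F x = x) (hinj : Function.Injective (inducedPi F N x)) (n : ℕ) (γ δ : C(N → I, X))
    (hγ : ∀ y ∈ Cube.boundary N, γ y = x) (hδ : ∀ y, δ y = F^[n] (γ y))
    (hnull : δ.HomotopicRel (.const _ x) (Cube.boundary N)) :
    γ.HomotopicRel (.const _ x) (Cube.boundary N) := by
  induction n generalizing γ with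
  | zero =>
    obtain rfl : δ = γ := by ext y; exact hδ y
    exact hnull
  | succ n ih =>
    have hF : (F.comp γ).HomotopicRel (F.comp (.const _ x)) (Cube.boundary N) := by
      have := ih (F.comp γ) (fun y hy => by simp [hγ y hy, hFx]) hδ
      convert this using 1
      ext y
      simp [hFx]
    have heq : (⟦⟨γ, hγ⟩⟧ : HomotopyGroup N X x) = ⟦GenLoop.const⟧ :=
      hinj (Quotient.sound hF)
    exact Quotient.exact heq

end Homotopy

/-- If `U ⊆ ℂⁿ` is a bounded connected open set and `f : U → U` is holomorphic with `f(U)`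
contained in a compact subset of `U` and fixed point `z₀`, and if for every `k ≥ 1` the
induced map `f_* : π_k(U, z₀) → π_k(U, z₀)` is an isomorphism, then `π_k(U, z₀) = 0` for
every `k ≥ 1`. -/
theorem homotopy_groups_trivial_of_contraction {n : ℕ}
    (U : Set (EuclideanSpace ℂ (Fin n)))
    (hUo : IsOpen U) (hUc : IsConnected U) (hUb : Bornology.IsBounded U)
    (f : EuclideanSpace ℂ (Fin n) → EuclideanSpace ℂ (Fin n))
    (hf : DifferentiableOn ℂ f U) (hmaps : Set.MapsTo f U U)
    (K : Set (EuclideanSpace ℂ (Fin n))) (hK : IsCompact K) (hKU : K ⊆ U) (hfK : f '' U ⊆ K)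
    (x₀ : U) (hfix : f x₀ = (x₀ : EuclideanSpace ℂ (Fin n)))
    (F : C(U, U)) (hF : ∀ z : U, (F z : EuclideanSpace ℂ (Fin n)) = f z)
    (hFx₀ : F x₀ = x₀)
    (hiso : ∀ k : ℕ, 1 ≤ k → Function.Bijective (inducedPi F (Fin k) x₀)) :
    ∀ k : ℕ, 1 ≤ k → Subsingleton (HomotopyGroup (Fin k) U x₀) := by
  intro k hk
  suffices h : ∀ γ : Ω^ (Fin k) U x₀, γ.1.HomotopicRel (.const _ x₀) (Cube.boundary (Fin k)) by
    refine ⟨fun a b => ?_⟩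
    induction a using Quotient.inductionOn
    induction b using Quotient.inductionOn
    exact Quotient.sound ((h _).trans (h _).symm)
  intro γ
  obtain ⟨r, hr, hrU⟩ := Metric.isOpen_iff.1 hUo x₀ x₀.2
  have hcomp : IsCompact (Set.range fun y => (γ y : EuclideanSpace ℂ (Fin n))) :=
    isCompact_range (continuous_subtype_val.comp γ.1.continuous)
  have hunif := (tendstoLocallyUniformlyOn_iff_forall_isCompact hUo).1
    (tendstoLocallyUniformlyOn_iterate hUo hUc.isPreconnected hUb hf hmaps hK hKU hfK x₀.2 hfix)
    _ (Set.range_subset_iff.2 fun y => (γ y).2) hcomp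
  obtain ⟨m, hm⟩ := (Metric.tendstoUniformlyOn_iff.1 hunif r hr).exists
  have hFf : ∀ z : U, ((F^[m] z : U) : EuclideanSpace ℂ (Fin n)) = f^[m] z :=
    (Function.Semiconj.iterate_right (f := ((↑) : U → EuclideanSpace ℂ (Fin n))) hF m)
  refine homotopicRel_const_of_iterate hFx₀ (hiso k hk).injective m γ.1
    ⟨fun y => F^[m] (γ y), (F.continuous.iterate m).comp γ.1.continuous⟩ γ.2 (fun y => rfl) ?_
  refine ContinuousMap.homotopicRel_of_convex (convex_ball (x₀ : EuclideanSpace ℂ (Fin n)) r) hrU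
    _ _ (fun y => ?_) (fun y => Metric.mem_ball_self hr) (fun y hy => ?_)
  · rw [Metric.mem_ball']
    simpa only [ContinuousMap.coe_mk, hFf] using hm _ (Set.mem_range_self y)
  · simp [GenLoop.boundary γ y hy, Function.iterate_fixed hFx₀]
end

section
/- Let U be a bounded connected open set with smooth boundary in ℂⁿ, and suppose there exists a holomorphic map f : U → U such that f(U) is contained in a compact subset of U and, for some z ∈ U and all k ≥ 1, the induced map f_* : π_k(U, z) → π_k(U, f(z)) is an isomorphism. Then U is contractible. -/
open Topology Topology.Homotopy

/-- A bounded open set has smooth boundary if it is the sublevel set `{ρ < 0}` of a smooth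
defining function `ρ` whose differential does not vanish on the boundary `{ρ = 0}`. -/
def HasSmoothBoundary {E : Type*} [NormedAddCommGroup E] [NormedSpace ℝ E]
    (U : Set E) : Prop :=
  ∃ ρ : E → ℝ, ContDiff ℝ (⊤ : ℕ∞) ρ ∧ (∀ x, x ∈ U ↔ ρ x < 0) ∧
    ∀ x ∈ frontier U, fderiv ℝ ρ x ≠ 0

section Holomorphic

open Set Filter Metric

variable {E : Type*} [NormedAddCommGroup E] [NormedSpace ℂ E] {U : Set E} {f : E → E}

/-- If `w ↦ f w + ε (f w - f x)` maps `U` to itself for all `x ∈ U`, then the derivatives of the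
iterates of `f` are those of self-maps of `U`, scaled by powers of `(1 + ε)⁻¹`. -/
theorem exists_fderiv_iterate_eq (hU : IsOpen U) (hf : DifferentiableOn ℂ f U)
    (hmaps : MapsTo f U U) {ε : ℝ} (hε : 0 < ε)
    (hexp : ∀ x ∈ U, MapsTo (fun w => f w + (ε : ℂ) • (f w - f x)) U U) (n : ℕ) :
    ∀ x ∈ U, ∃ h : E → E, DifferentiableOn ℂ h U ∧ MapsTo h U U ∧
      fderiv ℂ f^[n] x = (((1 + ε)⁻¹ ^ n : ℝ) : ℂ) • fderiv ℂ h x := by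
  induction n with
  | zero => exact fun x _ => ⟨id, differentiableOn_id, mapsTo_id U, by simp⟩
  | succ n ih =>
    intro x hx
    obtain ⟨h, hd, hm, he⟩ := ih (f x) (hmaps hx)
    set g : E → E := fun w => f w + (ε : ℂ) • (f w - f x) with hg
    have hgx : g x = f x := by simp [hg]
    have hfd : DifferentiableAt ℂ f x := hf.differentiableAt (hU.mem_nhds hx)
    have hgD : HasFDerivAt g ((1 + ε : ℂ) • fderiv ℂ f x) x := by
      have := hfd.hasFDerivAt.add ((hfd.hasFDerivAt.sub_const (f x)).const_smul (ε : ℂ))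
      rw [add_smul, one_smul]
      exact this
    have hgd : DifferentiableOn ℂ g U :=
      hf.add ((hf.sub_const (f x)).const_smul (ε : ℂ))
    refine ⟨h ∘ g, hd.comp hgd (hexp x hx), hm.comp (hexp x hx), ?_⟩
    have hit : ∀ m, DifferentiableOn ℂ f^[m] U := by
      intro m
      induction m with
      | zero => exact differentiableOn_id
      | succ m ihm => exact ihm.comp hf hmaps
    have h1 : fderiv ℂ f^[n + 1] x = (fderiv ℂ f^[n] (f x)).comp (fderiv ℂ f x) := by
      rw [Function.iterate_succ]
      exact fderiv_comp x ((hit n).differentiableAt (hU.mem_nhds (hmaps hx))) hfd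
    have h2 : fderiv ℂ (h ∘ g) x = (fderiv ℂ h (f x)).comp ((1 + ε : ℂ) • fderiv ℂ f x) := by
      rw [fderiv_comp x _ hgD.differentiableAt, hgx, hgD.fderiv]
      exact hd.differentiableAt (hU.mem_nhds (hgx ▸ hmaps hx))
    rw [h1, h2, he, ContinuousLinearMap.comp_smul, ContinuousLinearMap.smul_comp, smul_smul]
    congr 1
    have : (1 + ε : ℂ) ≠ 0 := by exact_mod_cast (by positivity : (1 + ε) ≠ 0)
    push_cast
    rw [pow_succ, mul_assoc, inv_mul_cancel₀ this, mul_one]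

/-- Iterates of a holomorphic self-map with relatively compact image contract compact sets. -/
theorem eventually_dist_iterate_lt (hU : IsOpen U) (hUc : IsPreconnected U)
    (hUb : Bornology.IsBounded U) (hf : DifferentiableOn ℂ f U) {K : Set E} (hK : IsCompact K)
    (hKU : K ⊆ U) (hfK : MapsTo f U K) {C : Set E} (hC : IsCompact C) (hCU : C ⊆ U) {p : E}
    (hp : p ∈ U) {δ : ℝ} (hδ : 0 < δ) :
    ∀ᶠ n in atTop, ∀ y ∈ C, dist (f^[n] p) (f^[n] y) < δ := by
  have hmaps : MapsTo f U U := fun x hx => hKU (hfK hx)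
  obtain ⟨r, hr, hrU⟩ := hK.exists_thickening_subset_open hU hKU
  obtain ⟨D, hD⟩ := isBounded_iff.1 hK.isBounded
  obtain ⟨M, hM⟩ := isBounded_iff.1 hUb
  have hD0 : 0 ≤ D := dist_nonneg.trans (hD (hfK hp) (hfK hp))
  have hM0 : 0 ≤ M := dist_nonneg.trans (hM hp hp)
  set ε : ℝ := r / (2 * (D + 1)) with hε_def
  have hε : 0 < ε := by positivity
  have hexp : ∀ x ∈ U, MapsTo (fun w => f w + (ε : ℂ) • (f w - f x)) U U := by
    intro x hx w hw
    refine hrU (mem_thickening_iff.2 ⟨f w, hfK hw, ?_⟩)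
    rw [dist_eq_norm, add_sub_cancel_left, norm_smul, ← dist_eq_norm, Complex.norm_real,
      Real.norm_of_nonneg hε.le]
    calc ε * dist (f w) (f x) ≤ ε * D := by gcongr; exact hD (hfK hw) (hfK hx)
      _ < ε * (2 * (D + 1)) := by gcongr; linarith
      _ = r := by rw [hε_def]; field_simp
  have hc0 : 0 ≤ (1 + ε)⁻¹ := by positivity
  have hc1 : (1 + ε)⁻¹ < 1 := inv_lt_one_of_one_lt₀ (by linarith)
  have hit : ∀ m, DifferentiableOn ℂ f^[m] U := by
    intro m
    induction m with
    | zero => exact differentiableOn_id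
    | succ m ihm => exact ihm.comp hf hmaps
  have hloc : ∀ x ∈ U, ∃ V ∈ 𝓝 x, ∀ δ > 0, ∀ᶠ n in atTop, ∀ y ∈ V,
      dist (f^[n] x) (f^[n] y) < δ := by
    intro x hx
    obtain ⟨s, hs, hsU⟩ := Metric.isOpen_iff.1 hU x hx
    refine ⟨ball x (s / 2), ball_mem_nhds x (by positivity), fun δ hδ => ?_⟩
    have hfd : ∀ n, ∀ y ∈ ball x (s / 2),
        ‖fderiv ℂ f^[n] y‖ ≤ (1 + ε)⁻¹ ^ n * (M / (s / 2)) := by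
      intro n y hy
      have hball : ball y (s / 2) ⊆ U := by
        refine Subset.trans (ball_subset_ball' ?_) hsU
        rw [mem_ball] at hy
        linarith
      have hyU : y ∈ U := hball (mem_ball_self (by positivity))
      obtain ⟨h, hd, hm, he⟩ := exists_fderiv_iterate_eq hU hf hmaps hε hexp n y hyU
      rw [he, norm_smul, Complex.norm_real, Real.norm_of_nonneg (by positivity)]
      gcongr
      refine Complex.norm_fderiv_le_div_of_mapsTo_ball (hd.mono hball) ?_ (by positivity)
      exact fun z hz => mem_closedBall.2 (hM (hm (hball hz)) (hm hyU))
    have hlim : Tendsto (fun n : ℕ => (1 + ε)⁻¹ ^ n * (M / (s / 2)) * (s / 2)) atTop (𝓝 0) := by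
      simpa using ((tendsto_pow_atTop_nhds_zero_of_lt_one hc0 hc1).mul_const
        (M / (s / 2))).mul_const (s / 2)
    filter_upwards [hlim.eventually_lt_const hδ] with n hn y hy
    refine lt_of_le_of_lt ?_ hn
    rw [dist_comm, dist_eq_norm]
    have := (convex_ball x (s / 2)).norm_image_sub_le_of_norm_fderiv_le (𝕜 := ℂ)
      (fun z hz => (hit n).differentiableAt
        (hU.mem_nhds (hsU (ball_subset_ball (by linarith) hz)))) (hfd n)
      (mem_ball_self (by positivity)) hy
    refine this.trans ?_
    gcongr
    exact (mem_ball_iff_norm.1 hy).le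
  have hpt : ∀ y ∈ U, Tendsto (fun n => dist (f^[n] p) (f^[n] y)) atTop (𝓝 0) := by
    intro y hy
    refine hUc.induction₂ (fun a b => Tendsto (fun n => dist (f^[n] a) (f^[n] b)) atTop (𝓝 0))
      (fun x hx => ?_) ?_ ?_ hp hy
    · obtain ⟨V, hV, hVx⟩ := hloc x hx
      filter_upwards [mem_nhdsWithin_of_mem_nhds hV] with z hz
      refine Metric.tendsto_atTop'.2 fun δ hδ => ?_
      obtain ⟨N, hN⟩ := eventually_atTop.1 (hVx δ hδ)
      exact ⟨N, fun n hn => by simpa using hN n hn.le z hz⟩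
    · intro a b c _ _ _ hab hbc
      refine squeeze_zero (fun n => dist_nonneg) (fun n => dist_triangle _ (f^[n] b) _) ?_
      simpa using hab.add hbc
    · intro a b _ _ hab
      simpa only [dist_comm] using hab
  have := hC.induction_on (p := fun S => ∀ δ > 0, ∀ᶠ n in atTop, ∀ y ∈ S,
      dist (f^[n] p) (f^[n] y) < δ) (by simp)
    (fun s t hst ht δ hδ => (ht δ hδ).mono fun n hn y hy => hn y (hst hy))
    (fun s t hs ht δ hδ => by
      filter_upwards [hs δ hδ, ht δ hδ] with n h1 h2 y hy
      exact hy.elim (h1 y) (h2 y))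
    (fun x hx => by
      obtain ⟨V, hV, hVx⟩ := hloc x (hCU hx)
      refine ⟨V, mem_nhdsWithin_of_mem_nhds hV, fun δ hδ => ?_⟩
      filter_upwards [hVx (δ / 2) (by positivity),
        (hpt x (hCU hx)).eventually_lt_const (half_pos hδ)] with n h1 h2 y hy
      linarith [dist_triangle (f^[n] p) (f^[n] x) (f^[n] y), h1 y hy])
  exact this δ hδ

end Holomorphic

section Extension

open Set Filter

/-- Every continuous map `A → U` extends to a continuous map `Q → U`. -/
def ExtendsTo {Y E : Type*} [TopologicalSpace Y] [TopologicalSpace E] (u : Y → E) (A Q : Set Y)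
    (U : Set E) : Prop :=
  ∃ v : Y → E, ContinuousOn v Q ∧ MapsTo v Q U ∧ EqOn v u A

variable {Y E : Type*} [MetricSpace Y] [NormedAddCommGroup E] [NormedSpace ℝ E]
  [FiniteDimensional ℝ E] {U : Set E} {A Q : Set Y}

/-- **Borsuk's homotopy extension theorem** for maps into an open subset of a
finite-dimensional space. -/
theorem exists_homotopy_extension (hU : IsOpen U) (hQ : IsClosed Q) (hA : IsClosed A)
    {u : Y → E} {H : Y × ℝ → E} (hu : ContinuousOn u Q) (huU : MapsTo u Q U)
    (hH : ContinuousOn H (A ×ˢ Icc 0 1)) (hHU : MapsTo H (A ×ˢ Icc 0 1) U)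
    (h0 : ∀ y ∈ A, H (y, 0) = u y) :
    ∃ G : Y × ℝ → E, ContinuousOn G (Q ×ˢ Icc 0 1) ∧ MapsTo G (Q ×ˢ Icc 0 1) U ∧
      (∀ y ∈ Q, G (y, 0) = u y) ∧ EqOn G H (A ×ˢ Icc 0 1) := by
  classical
  have : TietzeExtension.{_} E := TietzeExtension.of_tvs ℝ
  set S : Set (Y × ℝ) := A ×ˢ Icc 0 1 ∪ Q ×ˢ {0} with hS_def
  have hQS : ∀ y ∈ Q, (y, (0 : ℝ)) ∈ S := fun y hy => Or.inr ⟨hy, mem_singleton _⟩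
  have hS : IsClosed S := (hA.prod isClosed_Icc).union (hQ.prod isClosed_singleton)
  set H' : Y × ℝ → E := fun p => if p ∈ A ×ˢ Icc (0 : ℝ) 1 then H p else u p.1 with hH'_def
  have hH'1 : EqOn H' H (A ×ˢ Icc 0 1) := fun p hp => if_pos hp
  have hH'2 : EqOn H' (fun p => u p.1) (Q ×ˢ {0}) := by
    rintro ⟨y, t⟩ ⟨hy, ht : t = 0⟩
    subst ht
    by_cases hyA : y ∈ A
    · rw [hH'1 ⟨hyA, by simp⟩, h0 y hyA]
    · exact if_neg fun h => hyA h.1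
  have hcont : ContinuousOn H' S :=
    (hH.congr hH'1).union_of_isClosed
      ((hu.comp continuousOn_fst fun p hp => hp.1).congr hH'2)
      (hA.prod isClosed_Icc) (hQ.prod isClosed_singleton)
  have hmap : MapsTo H' S U := by
    rintro p (hp | hp)
    · rw [hH'1 hp]; exact hHU hp
    · rw [hH'2 hp]; exact huU hp.1
  obtain ⟨g, hg⟩ := ContinuousMap.exists_restrict_eq hS ⟨S.domRestrict H', hcont.domRestrict⟩
  have hgS : ∀ p ∈ S, g p = H' p := fun p hp => DFunLike.congr_fun hg ⟨p, hp⟩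
  set W : Set Y := {y | ∀ t ∈ Icc (0 : ℝ) 1, g (y, t) ∈ U} with hW_def
  have hW : IsOpen W := by
    refine isOpen_iff_mem_nhds.2 fun y hy => ?_
    refine isCompact_Icc.eventually_forall_of_forall_eventually fun t ht => ?_
    exact (g.continuous.tendsto _).eventually (hU.mem_nhds (hy t ht))
  have hAW : A ⊆ W := fun y hy t ht => by
    rw [hgS _ (Or.inl ⟨hy, ht⟩)]
    exact hmap (Or.inl ⟨hy, ht⟩)
  obtain ⟨l, hl0, hl1, hl⟩ := exists_continuous_zero_one_of_isClosed hW.isClosed_compl hA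
    (disjoint_compl_left_iff_subset.2 hAW)
  refine ⟨fun p => g (p.1, l p.1 * p.2), by fun_prop, ?_, ?_, ?_⟩
  · rintro ⟨y, t⟩ ⟨hy, ht⟩
    by_cases hyW : y ∈ W
    · exact hyW _ ⟨mul_nonneg (hl y).1 ht.1, mul_le_one₀ (hl y).2 ht.1 ht.2⟩
    · have : l y = 0 := hl0 hyW
      simp only [this, zero_mul]
      rw [hgS _ (hQS y hy)]
      exact hmap (hQS y hy)
  · intro y hy
    simp only [mul_zero]
    rw [hgS _ (hQS y hy), hH'2 ⟨hy, mem_singleton _⟩]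
  · rintro ⟨y, t⟩ ⟨hy, ht⟩
    have : l y = 1 := hl1 hy
    simp only [this, one_mul]
    rw [hgS _ (Or.inl ⟨hy, ht⟩), hH'1 ⟨hy, ht⟩]

theorem ExtendsTo.of_homotopy (hU : IsOpen U) (hQ : IsClosed Q) (hA : IsClosed A)
    {u u' : Y → E} (hu : ExtendsTo u A Q U) {H : Y × ℝ → E}
    (hH : ContinuousOn H (A ×ˢ Icc 0 1)) (hHU : MapsTo H (A ×ˢ Icc 0 1) U)
    (h0 : ∀ y ∈ A, H (y, 0) = u y) (h1 : ∀ y ∈ A, H (y, 1) = u' y) :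
    ExtendsTo u' A Q U := by
  obtain ⟨v, hv, hvU, hvu⟩ := hu
  obtain ⟨G, hG, hGU, -, hGH⟩ := exists_homotopy_extension hU hQ hA hv hvU hH hHU
    fun y hy => (h0 y hy).trans (hvu hy).symm
  refine ⟨fun y => G (y, 1), hG.comp (by fun_prop) fun y hy => ⟨hy, by simp⟩,
    fun y hy => hGU ⟨hy, by simp⟩, fun y hy => ?_⟩
  exact (hGH ⟨hy, by simp⟩).trans (h1 y hy)

theorem ExtendsTo.of_homotopy_symm (hU : IsOpen U) (hQ : IsClosed Q) (hA : IsClosed A)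
    {u u' : Y → E} (hu : ExtendsTo u' A Q U) {H : Y × ℝ → E}
    (hH : ContinuousOn H (A ×ˢ Icc 0 1)) (hHU : MapsTo H (A ×ˢ Icc 0 1) U)
    (h0 : ∀ y ∈ A, H (y, 0) = u y) (h1 : ∀ y ∈ A, H (y, 1) = u' y) :
    ExtendsTo u A Q U := by
  have hmt : MapsTo (fun p : Y × ℝ => (p.1, 1 - p.2)) (A ×ˢ Icc 0 1) (A ×ˢ Icc 0 1) := by
    rintro ⟨y, t⟩ ⟨hy, ht⟩
    exact ⟨hy, by simpa using ht.2, by simpa using ht.1⟩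
  exact hu.of_homotopy hU hQ hA (H := fun p => H (p.1, 1 - p.2))
    (hH.comp (by fun_prop) hmt) (fun p hp => hHU (hmt hp)) (by simpa using h1) (by simpa using h0)

theorem ExtendsTo.of_convex (hU : IsOpen U) (hQ : IsClosed Q) (hA : IsClosed A)
    {u : Y → E} (hu : ContinuousOn u A) {B : Set E} (hB : Convex ℝ B)
    (hBU : B ⊆ U) (huB : MapsTo u A B) {b : E} (hb : b ∈ B) : ExtendsTo u A Q U := by
  have hc : ExtendsTo (fun _ : Y => b) A Q U :=
    ⟨fun _ => b, continuousOn_const, fun _ _ => hBU hb, fun _ _ => rfl⟩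
  refine hc.of_homotopy hU hQ hA (H := fun p => AffineMap.lineMap b (u p.1) p.2) ?_ ?_
    (by simp) (by simp)
  · simp only [AffineMap.lineMap_apply_module]
    have : ContinuousOn (fun p : Y × ℝ => u p.1) (A ×ˢ Icc (0 : ℝ) 1) :=
      hu.comp continuousOn_fst fun p hp => hp.1
    exact ((continuousOn_const.sub continuousOn_snd).smul continuousOn_const).add
      (continuousOn_snd.smul this)
  · rintro ⟨y, t⟩ ⟨hy, ht⟩
    exact hBU (hB.lineMap_mem hb (huB hy) ht)

end Extension

section Cube

open Set Filter

/-- The unit cube of dimension `k + 1`. -/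
def prismCube (k : ℕ) : Set ((Fin k → ℝ) × ℝ) := Icc 0 1 ×ˢ Icc 0 1

/-- The union of the bottom and vertical faces of `prismCube k`. -/
def prismBox (k : ℕ) : Set ((Fin k → ℝ) × ℝ) :=
  prismCube k ∩ {p | (∃ i, p.1 i = 0 ∨ p.1 i = 1) ∨ p.2 = 0}

/-- The boundary of `prismCube k`. -/
def prismBoundary (k : ℕ) : Set ((Fin k → ℝ) × ℝ) :=
  prismCube k ∩ {p | (∃ i, p.1 i = 0 ∨ p.1 i = 1) ∨ p.2 = 0 ∨ p.2 = 1}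

variable {k : ℕ}

theorem isCompact_prismCube : IsCompact (prismCube k) := isCompact_Icc.prod isCompact_Icc

theorem isClosed_prismCube : IsClosed (prismCube k) := isCompact_prismCube.isClosed

theorem isClosed_exists_side :
    IsClosed {p : (Fin k → ℝ) × ℝ | ∃ i, p.1 i = 0 ∨ p.1 i = 1} := by
  rw [ofPred_exists]
  refine isClosed_iUnion_of_finite fun i => ?_
  exact (isClosed_eq (by fun_prop) (by fun_prop)).union
    (isClosed_eq (by fun_prop) (by fun_prop))

theorem isClosed_prismBox : IsClosed (prismBox k) :=
  isClosed_prismCube.inter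
    (isClosed_exists_side.union (isClosed_eq continuous_snd continuous_const))

theorem isClosed_prismBoundary : IsClosed (prismBoundary k) :=
  isClosed_prismCube.inter
    (isClosed_exists_side.union ((isClosed_eq continuous_snd continuous_const).union
      (isClosed_eq continuous_snd continuous_const)))

theorem prismBoundary_subset : prismBoundary k ⊆ prismCube k := inter_subset_left

theorem prismBox_subset : prismBox k ⊆ prismBoundary k :=
  fun _ hp => ⟨hp.1, hp.2.imp_right Or.inl⟩

variable {E : Type*} [TopologicalSpace E] {U : Set E}

/-- A map which is constant on `prismBox k` and whose composition with `f` extends to the cube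
itself extends, provided that `f` is injective on the `k`-th homotopy group. -/
theorem extendsTo_of_comp_of_eqOn_const {f : E → E} {F : C(U, U)} (hF : ∀ z : U, (F z : E) = f z)
    {x : U} (hinj : Function.Injective (inducedPi F (Fin k) x)) {u : (Fin k → ℝ) × ℝ → E}
    (hu : ContinuousOn u (prismBoundary k)) (huU : MapsTo u (prismBoundary k) U)
    (hux : ∀ p ∈ prismBox k, u p = x) (hfu : ExtendsTo (f ∘ u) (prismBoundary k) (prismCube k) U) :
    ExtendsTo u (prismBoundary k) (prismCube k) U := by
  obtain ⟨v, hv, hvU, hvu⟩ := hfu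
  have hmem : ∀ (y : Fin k → unitInterval) (t : unitInterval),
      ((fun i => (y i : ℝ)), (t : ℝ)) ∈ prismCube k := fun y t =>
    ⟨⟨fun i => (y i).2.1, fun i => (y i).2.2⟩, t.2⟩
  have hbox : ∀ (y : Fin k → unitInterval) (t : unitInterval), y ∈ Cube.boundary (Fin k) →
      ((fun i => (y i : ℝ)), (t : ℝ)) ∈ prismBox k := by
    rintro y t ⟨i, hi⟩
    refine ⟨hmem y t, Or.inl ⟨i, hi.imp (fun h => ?_) fun h => ?_⟩⟩ <;> simp [h]
  have htop : ∀ y : Fin k → unitInterval, ((fun i => (y i : ℝ)), (1 : ℝ)) ∈ prismBoundary k :=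
    fun y => ⟨hmem y 1, Or.inr (Or.inr rfl)⟩
  have hbot : ∀ y : Fin k → unitInterval, ((fun i => (y i : ℝ)), (0 : ℝ)) ∈ prismBox k :=
    fun y => ⟨hmem y 0, Or.inr rfl⟩
  set g : GenLoop (Fin k) U x := ⟨⟨fun y => ⟨u (fun i => (y i : ℝ), 1), huU (htop y)⟩,
    (hu.comp_continuous (by fun_prop) htop).subtype_mk _⟩,
    fun y hy => Subtype.ext (hux _ (hbox y 1 hy))⟩ with hg
  have hFg : inducedPi F (Fin k) x ⟦g⟧ = inducedPi F (Fin k) x ⟦GenLoop.const⟧ := by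
    refine Quotient.sound ⟨⟨⟨⟨fun p => ⟨v (fun i => (p.2 i : ℝ), ((unitInterval.symm p.1 :) : ℝ)),
      hvU (hmem _ _)⟩, ?_⟩, ?_, ?_⟩, ?_⟩⟩
    · exact (hv.comp_continuous (by fun_prop) fun p => hmem _ _).subtype_mk _
    · intro y
      refine Subtype.ext ?_
      simp only [unitInterval.symm_zero, Set.Icc.coe_one]
      rw [hvu (htop y)]
      exact (hF (g.1 y)).symm
    · intro y
      refine Subtype.ext ?_
      simp only [unitInterval.symm_one, Set.Icc.coe_zero]
      rw [hvu (prismBox_subset (hbot y)), Function.comp_apply, hux _ (hbot y)]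
      exact (hF _).symm
    · intro t y hy
      refine Subtype.ext ?_
      have h1 := hbox y (unitInterval.symm t) hy
      have h2 := hbox y 1 hy
      change v _ = (F (g.1 y) : E)
      rw [hvu (prismBox_subset h1), Function.comp_apply, hux _ h1, hF]
      exact congrArg f (hux _ h2).symm
  obtain ⟨H⟩ := Quotient.exact (hinj hFg)
  set P : ℝ → unitInterval := projIcc 0 1 zero_le_one with hP
  have hPc : Continuous P := continuous_projIcc
  have hPe : ∀ t (ht : t ∈ Icc (0 : ℝ) 1), P t = ⟨t, ht⟩ := fun t ht => projIcc_of_mem _ ht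
  refine ⟨fun p => (H (unitInterval.symm (P p.2), fun i => P (p.1 i)) : E), ?_, ?_, ?_⟩
  · exact Continuous.continuousOn (by fun_prop)
  · exact fun p _ => Subtype.prop _
  · rintro ⟨y, t⟩ ⟨⟨⟨hy0, hy1⟩, ht⟩, hb⟩
    obtain ⟨y, rfl⟩ : ∃ y' : Fin k → unitInterval, y = fun i => (y' i : ℝ) :=
      ⟨fun i => ⟨y i, hy0 i, hy1 i⟩, rfl⟩
    obtain ⟨t, rfl⟩ : ∃ t' : unitInterval, t = t' := ⟨⟨t, ht⟩, rfl⟩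
    have hPv : ∀ s : unitInterval, P s = s := fun s => projIcc_val _ s
    simp only [hPv]
    rcases hb with ⟨i, hi⟩ | hb | hb
    · have hyb : y ∈ Cube.boundary (Fin k) :=
        ⟨i, hi.imp (fun h => Subtype.ext h) fun h => Subtype.ext h⟩
      rw [hux _ (hbox y t hyb), H.eq_fst _ hyb]
      exact hux _ (hbox y 1 hyb)
    · have : t = 0 := Subtype.ext hb
      subst this
      rw [unitInterval.symm_zero, H.apply_one]
      exact (hux _ (hbot y)).symm
    · have : t = 1 := Subtype.ext hb
      subst this
      rw [unitInterval.symm_one, H.apply_zero]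
      rfl

theorem extendsTo_of_isPathConnected (hUp : IsPathConnected U) {u : (Fin 0 → ℝ) × ℝ → E}
    (huU : MapsTo u (prismBoundary 0) U) :
    ExtendsTo u (prismBoundary 0) (prismCube 0) U := by
  have hm : ∀ t, t = 0 ∨ t = 1 → ((0 : Fin 0 → ℝ), t) ∈ prismBoundary 0 := by
    rintro t (rfl | rfl)
    · exact ⟨⟨by simp, by simp⟩, by simp⟩
    · exact ⟨⟨by simp, by simp⟩, by simp⟩
  obtain ⟨p, hp⟩ := hUp.joinedIn _ (huU (hm 0 (Or.inl rfl))) _ (huU (hm 1 (Or.inr rfl)))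
  refine ⟨fun q => p.extend q.2, Continuous.continuousOn (by fun_prop), ?_, ?_⟩
  · rintro q -
    obtain ⟨t, ht⟩ : p.extend q.2 ∈ range p := p.extend_range ▸ mem_range_self _
    change p.extend q.2 ∈ U
    exact ht ▸ hp t
  · rintro ⟨y, t⟩ ⟨-, ⟨i, -⟩ | ht⟩
    · exact i.elim0
    · obtain rfl : y = 0 := Subsingleton.elim _ _
      simp only at ht
      rcases ht with rfl | rfl <;> simp

end Cube

section CubeExtension

open Set Filter

variable {k : ℕ} {E : Type*} [NormedAddCommGroup E] [NormedSpace ℝ E]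
  [FiniteDimensional ℝ E] {U : Set E}

/-- Homotoping a map on `prismBox k` does not affect the conclusion that it extends to the cube as
soon as its composition with `f` does. -/
theorem extendsTo_of_comp_of_homotopy (hU : IsOpen U) {f : E → E} (hf : ContinuousOn f U)
    (hfU : MapsTo f U U) {u : (Fin k → ℝ) × ℝ → E} {c : E}
    (hu : ContinuousOn u (prismBoundary k)) (huU : MapsTo u (prismBoundary k) U)
    {H : ((Fin k → ℝ) × ℝ) × ℝ → E} (hH : ContinuousOn H (prismBox k ×ˢ Icc 0 1))
    (hHU : MapsTo H (prismBox k ×ˢ Icc 0 1) U) (h0 : ∀ y ∈ prismBox k, H (y, 0) = u y)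
    (h1 : ∀ y ∈ prismBox k, H (y, 1) = c)
    (hc : ∀ u' : (Fin k → ℝ) × ℝ → E, ContinuousOn u' (prismBoundary k) →
      MapsTo u' (prismBoundary k) U → (∀ p ∈ prismBox k, u' p = c) →
      ExtendsTo (f ∘ u') (prismBoundary k) (prismCube k) U →
      ExtendsTo u' (prismBoundary k) (prismCube k) U)
    (hfu : ExtendsTo (f ∘ u) (prismBoundary k) (prismCube k) U) :
    ExtendsTo u (prismBoundary k) (prismCube k) U := by
  obtain ⟨G, hG, hGU, hG0, hGH⟩ := exists_homotopy_extension hU isClosed_prismBoundary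
    isClosed_prismBox hu huU hH hHU h0
  refine ExtendsTo.of_homotopy_symm (u' := fun y => G (y, 1)) hU isClosed_prismCube
    isClosed_prismBoundary ?_ hG hGU hG0 (fun _ _ => rfl)
  refine hc _ (hG.comp (by fun_prop) fun y hy => ⟨hy, by simp⟩)
    (fun y hy => hGU ⟨hy, by simp⟩) (fun y hy => ?_) ?_
  · exact (hGH ⟨hy, by simp⟩).trans (h1 y hy)
  · exact hfu.of_homotopy hU isClosed_prismCube isClosed_prismBoundary (H := f ∘ G)
      (hf.comp hG hGU) (hfU.comp hGU) (fun y hy => congrArg f (hG0 y hy)) (fun _ _ => rfl)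

theorem extendsTo_of_comp (hU : IsOpen U) (hUp : IsPathConnected U) {f : E → E}
    (hf : ContinuousOn f U) (hfU : MapsTo f U U) {F : C(U, U)} (hF : ∀ z : U, (F z : E) = f z)
    {x : U} (hinj : Function.Injective (inducedPi F (Fin k) x)) {u : (Fin k → ℝ) × ℝ → E}
    (hu : ContinuousOn u (prismBoundary k)) (huU : MapsTo u (prismBoundary k) U)
    (hfu : ExtendsTo (f ∘ u) (prismBoundary k) (prismCube k) U) :
    ExtendsTo u (prismBoundary k) (prismCube k) U := by
  have h00 : (0 : (Fin k → ℝ) × ℝ) ∈ prismBox k :=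
    ⟨⟨by simp, by simp⟩, Or.inr rfl⟩
  set a : ℝ → ℝ := fun t => min 1 (2 - 2 * t)
  set b : ℝ → ℝ := fun t => max 0 (1 - 2 * t)
  set γ : ((Fin k → ℝ) × ℝ) × ℝ → (Fin k → ℝ) × ℝ := fun p => (a p.2 • p.1.1, b p.2 * p.1.2)
    with hγ
  have hγc : Continuous γ := by fun_prop
  have hγm : MapsTo γ (prismBox k ×ˢ Icc 0 1) (prismBox k) := by
    rintro ⟨⟨y, s⟩, t⟩ ⟨⟨⟨⟨hy0, hy1⟩, hs0, hs1⟩, hb⟩, ht0, ht1⟩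
    simp only at hy0 hy1 hs0 hs1 ht0 ht1 hb
    have ha0 : 0 ≤ a t := le_min zero_le_one (by linarith)
    have ha1 : a t ≤ 1 := min_le_left _ _
    have hb0 : 0 ≤ b t := le_max_left _ _
    have hb1 : b t ≤ 1 := max_le zero_le_one (by linarith)
    refine ⟨⟨⟨fun i => mul_nonneg ha0 (hy0 i), fun i => mul_le_one₀ ha1 (hy0 i) (hy1 i)⟩,
      mul_nonneg hb0 hs0, mul_le_one₀ hb1 hs0 hs1⟩, ?_⟩
    rcases le_total t (1 / 2) with ht | ht
    · have : a t = 1 := min_eq_left (by linarith)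
      refine hb.imp (fun h => ?_) fun h => ?_
      · simpa [hγ, this] using h
      · simp only at h
        simp only [hγ]
        rw [h, mul_zero]
    · right
      have : b t = 0 := max_eq_left (by linarith)
      simp only [hγ]
      rw [this, zero_mul]
  refine extendsTo_of_comp_of_homotopy hU hf hfU hu huU (c := u 0) (H := u ∘ γ)
    ((hu.mono prismBox_subset).comp hγc.continuousOn hγm)
    (fun p hp => huU (prismBox_subset (hγm hp))) ?_ ?_ ?_ hfu
  · rintro p -
    simp [hγ, a, b]
  · rintro p -
    simp [hγ, a, b]
    rfl
  · intro u' hu' hu'U hu'c hfu'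
    obtain ⟨p, hp⟩ := hUp.joinedIn (u 0) (huU (prismBox_subset h00)) x x.2
    refine extendsTo_of_comp_of_homotopy hU hf hfU hu' hu'U (c := x) (H := fun q => p.extend q.2)
      (Continuous.continuousOn (by fun_prop)) ?_ ?_ ?_
      (fun u'' h1 h2 h3 => extendsTo_of_comp_of_eqOn_const hF hinj h1 h2 h3) hfu'
    · rintro q -
      obtain ⟨t, ht⟩ : p.extend q.2 ∈ range p := p.extend_range ▸ mem_range_self _
      change p.extend q.2 ∈ U
      exact ht ▸ hp t
    · intro y hy
      simp [hu'c y hy]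
    · simp

/-- A continuous self-map that is injective on `π_k` and some iterate of which shrinks compact
sets into convex subsets of `U` forces `k`-spheres in `U` to be contractible in `U`. -/
theorem extendsTo_of_iterate (hU : IsOpen U) (hUp : IsPathConnected U) {f : E → E}
    (hf : ContinuousOn f U) (hfU : MapsTo f U U) {F : C(U, U)} (hF : ∀ z : U, (F z : E) = f z)
    {x : U} (hinj : Function.Injective (inducedPi F (Fin k) x))
    (hshrink : ∀ C ⊆ U, IsCompact C → ∃ n, ∃ B ⊆ U, Convex ℝ B ∧ B.Nonempty ∧ MapsTo f^[n] C B)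
    {u : (Fin k → ℝ) × ℝ → E}
    (hu : ContinuousOn u (prismBoundary k)) (huU : MapsTo u (prismBoundary k) U) :
    ExtendsTo u (prismBoundary k) (prismCube k) U := by
  obtain ⟨n, B, hBU, hB, ⟨b, hb⟩, hn⟩ := hshrink (u '' prismBoundary k) huU.image_subset
    ((isCompact_prismCube.of_isClosed_subset isClosed_prismBoundary
      prismBoundary_subset).image_of_continuousOn hu)
  have key : ∀ m ≤ n, ExtendsTo (f^[m] ∘ u) (prismBoundary k) (prismCube k) U := by
    intro m hm
    induction hm using Nat.decreasingInduction with
    | self =>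
      exact .of_convex hU isClosed_prismCube isClosed_prismBoundary
        ((hf.iterate hfU n).comp hu huU) hB hBU (fun y hy => hn (mem_image_of_mem u hy)) hb
    | @of_succ m _ ih =>
      refine extendsTo_of_comp hU hUp hf hfU hF hinj ((hf.iterate hfU m).comp hu huU)
        ((hfU.iterate m).comp huU) ?_
      rwa [Function.iterate_succ'] at ih
  exact key 0 n.zero_le

end CubeExtension

section Simplex

open Set Filter

theorem interior_prismCube (k : ℕ) :
    interior (prismCube k) = {p | (∀ i, p.1 i ∈ Ioo (0 : ℝ) 1) ∧ p.2 ∈ Ioo (0 : ℝ) 1} := by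
  rw [prismCube, interior_prod_eq, interior_Icc, ← pi_univ_Icc, interior_pi_set finite_univ]
  ext p
  simp [interior_Icc]

theorem frontier_prismCube (k : ℕ) : frontier (prismCube k) = prismBoundary k := by
  rw [isClosed_prismCube.frontier_eq, interior_prismCube]
  ext ⟨y, t⟩
  refine and_congr_right fun ⟨⟨hy0, hy1⟩, ht0, ht1⟩ => ?_
  simp only at hy0 hy1 ht0 ht1
  have h1 : ∀ i, y i ∈ Ioo (0 : ℝ) 1 ↔ ¬ (y i = 0 ∨ y i = 1) := fun i => by
    rw [mem_Ioo, not_or, (show 0 ≤ y i from hy0 i).lt_iff_ne,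
      (show y i ≤ 1 from hy1 i).lt_iff_ne]
    exact and_congr_left' ne_comm
  have h2 : t ∈ Ioo (0 : ℝ) 1 ↔ ¬ (t = 0 ∨ t = 1) := by
    rw [mem_Ioo, not_or, ht0.lt_iff_ne, ht1.lt_iff_ne]
    exact and_congr_left' ne_comm
  simp only [mem_ofPred_eq, h1, h2, ← not_exists, ← not_or, not_not]

/-- The face of the (possibly infinite-dimensional) standard simplex on `V` spanned by `σ`. -/
def simplexFace {V : Type*} (σ : Finset V) : Set (V → ℝ) :=
  {w | (∀ i, 0 ≤ w i) ∧ (∀ i ∉ σ, w i = 0) ∧ ∑ i ∈ σ, w i = 1}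

/-- The boundary of `simplexFace σ`. -/
def simplexBoundary {V : Type*} (σ : Finset V) : Set (V → ℝ) :=
  simplexFace σ ∩ {w | ∃ i ∈ σ, w i = 0}

/-- The solid corner simplex in `ι → ℝ`. -/
def cornerSimplex (ι : Type*) [Fintype ι] : Set (ι → ℝ) :=
  {v | (∀ i, 0 ≤ v i) ∧ ∑ i, v i ≤ 1}

section Corner

variable {ι : Type*} [Fintype ι]

theorem isClosed_cornerSimplex : IsClosed (cornerSimplex ι) := by
  rw [cornerSimplex, ofPred_and, ofPred_forall]
  exact (isClosed_iInter fun i => isClosed_le continuous_const (continuous_apply i)).inter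
    (isClosed_le (by fun_prop) continuous_const)

theorem convex_cornerSimplex : Convex ℝ (cornerSimplex ι) := by
  rintro v ⟨hv0, hv1⟩ w ⟨hw0, hw1⟩ a b ha hb hab
  refine ⟨fun i => add_nonneg (mul_nonneg ha (hv0 i)) (mul_nonneg hb (hw0 i)), ?_⟩
  simp only [Pi.add_apply, Pi.smul_apply, smul_eq_mul, Finset.sum_add_distrib, ← Finset.mul_sum]
  nlinarith

theorem isBounded_cornerSimplex : Bornology.IsBounded (cornerSimplex ι) := by
  refine (Metric.isBounded_Icc (0 : ι → ℝ) 1).subset fun v hv => ⟨hv.1, fun i => ?_⟩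
  exact (Finset.single_le_sum (fun j _ => hv.1 j) (Finset.mem_univ i)).trans hv.2

theorem interior_cornerSimplex [Nonempty ι] :
    interior (cornerSimplex ι) = {v | (∀ i, 0 < v i) ∧ ∑ i, v i < 1} := by
  let l : (ι → ℝ) →ₗ[ℝ] ℝ := ∑ i, LinearMap.proj i
  have hl : ∀ v, l v = ∑ i, v i := fun v => by simp [l]
  have h : cornerSimplex ι = (univ.pi fun _ => Ici 0) ∩ l ⁻¹' Iic 1 := by
    ext v
    simp only [cornerSimplex, mem_ofPred_eq, mem_inter_iff, mem_univ_pi, mem_Ici, mem_preimage,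
      mem_Iic, hl]
  have hs : Function.Surjective l := by
    classical
    exact fun c => ⟨Pi.single (Classical.arbitrary ι) c, by simp [hl]⟩
  rw [h, interior_inter, interior_pi_set finite_univ,
    ← (l.isOpenMap_of_finiteDimensional hs).preimage_interior_eq_interior_preimage
      l.continuous_of_finiteDimensional, interior_Iic]
  ext v
  simp [hl]

theorem nonempty_interior_cornerSimplex [Nonempty ι] : (interior (cornerSimplex ι)).Nonempty := by
  rw [interior_cornerSimplex]
  refine ⟨fun _ => (Fintype.card ι + 1 : ℝ)⁻¹, fun i => by positivity, ?_⟩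
  simp only [Finset.sum_const, Finset.card_univ, nsmul_eq_mul]
  rw [← div_eq_mul_inv, div_lt_one (by positivity)]
  linarith

end Corner

variable {E : Type*} [TopologicalSpace E] {U : Set E} {k : ℕ}

/-- If maps to `U` from the boundary of the cube extend to the cube, then so do maps from the
boundary of any convex body of the same dimension. -/
theorem extendsTo_frontier_of_convex {W : Type*} [NormedAddCommGroup W] [NormedSpace ℝ W]
    [FiniteDimensional ℝ W] (hW : Module.finrank ℝ W = k + 1)
    (hcube : ∀ u : (Fin k → ℝ) × ℝ → E, ContinuousOn u (prismBoundary k) →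
      MapsTo u (prismBoundary k) U → ExtendsTo u (prismBoundary k) (prismCube k) U)
    {S : Set W} (hSc : IsClosed S) (hS : Convex ℝ S) (hSb : Bornology.IsBounded S)
    (hSi : (interior S).Nonempty) {u : W → E} (hu : ContinuousOn u (frontier S))
    (huU : MapsTo u (frontier S) U) : ExtendsTo u (frontier S) S U := by
  let L : ((Fin k → ℝ) × ℝ) ≃L[ℝ] W := ContinuousLinearEquiv.ofFinrankEq (by simp [hW])
  obtain ⟨e, -, he1, he2⟩ := exists_homeomorph_image_eq
    (s := prismCube k) (t := L ⁻¹' S) ((convex_Icc _ _).prod (convex_Icc _ _))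
    (by
      rw [interior_prismCube]
      exact ⟨(fun _ => 1 / 2, 1 / 2), by norm_num⟩)
    (NormedSpace.isVonNBounded_of_isBounded ℝ isCompact_prismCube.isBounded)
    (hS.linear_preimage L.toLinearMap)
    (by
      rw [show interior (L ⁻¹' S) = L ⁻¹' interior S from
        (L.toHomeomorph.preimage_interior S).symm]
      exact hSi.preimage L.surjective)
    (NormedSpace.isVonNBounded_of_isBounded ℝ (by
      rw [← L.image_symm_eq_preimage]
      exact L.symm.lipschitz.isBounded_image hSb))
  rw [frontier_prismCube, show frontier (L ⁻¹' S) = L ⁻¹' frontier S from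
    (L.toHomeomorph.preimage_frontier S).symm] at he2
  rw [isClosed_prismCube.closure_eq, (hSc.preimage L.continuous).closure_eq] at he1
  set φ := e.trans L.toHomeomorph with hφ
  have h1 : ∀ y, φ y ∈ S ↔ y ∈ prismCube k := fun y => by
    rw [← e.injective.mem_set_image, he1]; rfl
  have h2 : ∀ y, φ y ∈ frontier S ↔ y ∈ prismBoundary k := fun y => by
    rw [← e.injective.mem_set_image, he2]; rfl
  obtain ⟨v, hv, hvU, hvu⟩ := hcube (u ∘ φ)
    (hu.comp φ.continuous.continuousOn fun y hy => (h2 y).2 hy)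
    (fun y hy => huU ((h2 y).2 hy))
  have h1' : MapsTo φ.symm S (prismCube k) := fun y hy => (h1 _).1 (by simpa using hy)
  refine ⟨v ∘ φ.symm, hv.comp φ.symm.continuous.continuousOn h1', hvU.comp h1', fun y hy => ?_⟩
  rw [Function.comp_apply, hvu ((h2 _).1 (by simpa using hy)), Function.comp_apply,
    φ.apply_symm_apply]

theorem extendsTo_simplexFace {V : Type*}
    (hcube : ∀ u : (Fin k → ℝ) × ℝ → E, ContinuousOn u (prismBoundary k) →
      MapsTo u (prismBoundary k) U → ExtendsTo u (prismBoundary k) (prismCube k) U)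
    {σ : Finset V} (hσ : σ.card = k + 2) {u : (V → ℝ) → E}
    (hu : ContinuousOn u (simplexBoundary σ)) (huU : MapsTo u (simplexBoundary σ) U) :
    ExtendsTo u (simplexBoundary σ) (simplexFace σ) U := by
  classical
  obtain ⟨a, ha⟩ : σ.Nonempty := Finset.card_pos.1 (by omega)
  set τ := σ.erase a with hτ
  have hτc : τ.card = k + 1 := by rw [hτ, Finset.card_erase_of_mem ha, hσ]; rfl
  have haτ : a ∉ τ := Finset.notMem_erase a σ
  have hins : insert a τ = σ := Finset.insert_erase ha
  have : Nonempty τ := (Finset.card_pos.1 (by omega : 0 < τ.card)).to_subtype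
  set φ : (τ → ℝ) → V → ℝ := fun v i =>
    if h : i ∈ τ then v ⟨i, h⟩ else if i = a then 1 - ∑ j, v j else 0 with hφ
  set ψ : (V → ℝ) → τ → ℝ := fun w i => w i with hψ
  have hφa : ∀ v, φ v a = 1 - ∑ j, v j := fun v => by simp [hφ, haτ]
  have hφτ : ∀ v (i : τ), φ v i = v i := fun v i => by simp [hφ]
  have hφ0 : ∀ v, ∀ i ∉ σ, φ v i = 0 := fun v i hi => by
    have h1 : i ∉ τ := fun h => hi (Finset.mem_of_mem_erase h)
    have h2 : i ≠ a := fun h => hi (h ▸ ha)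
    simp [hφ, h1, h2]
  have hφc : Continuous φ := continuous_pi fun i => by
    simp only [hφ]
    split_ifs <;> fun_prop
  have hψc : Continuous ψ := by fun_prop
  have hsum : ∀ w : V → ℝ, ∑ i ∈ σ, w i = w a + ∑ i, ψ w i := fun w => by
    rw [← hins, Finset.sum_insert haτ, ← Finset.sum_coe_sort τ]
  have hψφ : ∀ v, ψ (φ v) = v := fun v => funext fun i => hφτ v i
  have hφψ : ∀ w ∈ simplexFace σ, φ (ψ w) = w := by
    rintro w ⟨-, hw0, hw1⟩
    funext i
    by_cases hi : i ∈ σ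
    · rw [← hins, Finset.mem_insert] at hi
      rcases hi with rfl | hi
      · rw [hφa]; linarith [hsum w]
      · exact hφτ _ ⟨i, hi⟩
    · rw [hφ0 _ i hi, hw0 i hi]
  have hψS : MapsTo ψ (simplexFace σ) (cornerSimplex τ) := by
    rintro w ⟨hw, -, hw1⟩
    exact ⟨fun i => hw i, by linarith [hsum w, hw a]⟩
  have hφS : MapsTo φ (cornerSimplex τ) (simplexFace σ) := by
    rintro v ⟨hv0, hv1⟩
    refine ⟨fun i => ?_, hφ0 v, ?_⟩
    · by_cases hi : i ∈ σ
      · rw [← hins, Finset.mem_insert] at hi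
        rcases hi with rfl | hi
        · rw [hφa]; linarith
        · exact (hφτ v ⟨i, hi⟩).symm ▸ hv0 _
      · rw [hφ0 _ i hi]
    · rw [hsum, hψφ, hφa]; ring
  have hfr : ∀ v, v ∈ frontier (cornerSimplex τ) ↔
      v ∈ cornerSimplex τ ∧ ((∃ i, v i = 0) ∨ ∑ i, v i = 1) := by
    intro v
    rw [isClosed_cornerSimplex.frontier_eq, interior_cornerSimplex]
    refine and_congr_right fun ⟨hv0, hv1⟩ => ?_
    simp only [mem_ofPred_eq, hv1.lt_iff_ne, fun i => (hv0 i).lt_iff_ne, ne_comm (a := (0 : ℝ)),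
      not_and_or, not_forall, not_not, ne_eq]
  have hφB : MapsTo φ (frontier (cornerSimplex τ)) (simplexBoundary σ) := by
    intro v hv
    obtain ⟨hv, h⟩ := (hfr v).1 hv
    refine ⟨hφS hv, ?_⟩
    rcases h with ⟨i, hi⟩ | h
    · exact ⟨i, Finset.mem_of_mem_erase i.2, (hφτ v i).trans hi⟩
    · exact ⟨a, ha, by rw [hφa, h, sub_self]⟩
  have hψB : MapsTo ψ (simplexBoundary σ) (frontier (cornerSimplex τ)) := by
    rintro w ⟨hw, i, hi, h⟩
    refine (hfr _).2 ⟨hψS hw, ?_⟩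
    rw [← hins, Finset.mem_insert] at hi
    rcases hi with rfl | hi
    · right; linarith [hsum w, hw.2.2]
    · exact Or.inl ⟨⟨i, hi⟩, h⟩
  obtain ⟨v, hv, hvU, hvu⟩ := extendsTo_frontier_of_convex (W := τ → ℝ) (by simp [hτc]) hcube
    isClosed_cornerSimplex convex_cornerSimplex isBounded_cornerSimplex
    nonempty_interior_cornerSimplex (hu.comp hφc.continuousOn hφB) (huU.comp hφB)
  refine ⟨v ∘ ψ, hv.comp hψc.continuousOn hψS, hvU.comp hψS, fun w hw => ?_⟩
  rw [Function.comp_apply, hvu (hψB hw), Function.comp_apply, hφψ w hw.1]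

end Simplex

section SimplexMap

open Set Filter

variable {V : Type*} {σ τ : Finset V} {w : V → ℝ}

theorem simplexFace_mono (h : σ ⊆ τ) : simplexFace σ ⊆ simplexFace τ := by
  rintro w ⟨hw, hw0, hw1⟩
  refine ⟨hw, fun i hi => hw0 i fun hiσ => hi (h hiσ), ?_⟩
  rw [← hw1]
  exact (Finset.sum_subset h fun i _ hi => hw0 i hi).symm

theorem mem_simplexFace_of_subset (hw : w ∈ simplexFace τ) (h : σ ⊆ τ)
    (h0 : ∀ i ∈ τ, i ∉ σ → w i = 0) : w ∈ simplexFace σ := by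
  refine ⟨hw.1, fun i hi => ?_, ?_⟩
  · by_cases hiτ : i ∈ τ
    · exact h0 i hiτ hi
    · exact hw.2.1 i hiτ
  · rw [← hw.2.2]
    exact Finset.sum_subset h h0

theorem isClosed_simplexFace : IsClosed (simplexFace σ) := by
  rw [simplexFace, ofPred_and, ofPred_and, ofPred_forall, ofPred_forall]
  refine (isClosed_iInter fun i => isClosed_le continuous_const (continuous_apply i)).inter
    (IsClosed.inter (isClosed_iInter fun i => ?_) (isClosed_eq (by fun_prop) continuous_const))
  rw [ofPred_forall]
  exact isClosed_iInter fun _ => isClosed_eq (continuous_apply i) continuous_const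

theorem simplexBoundary_eq_iUnion [DecidableEq V] :
    simplexBoundary σ = ⋃ i : σ, simplexFace (σ.erase i) := by
  ext w
  simp only [simplexBoundary, mem_inter_iff, mem_ofPred_eq, mem_iUnion]
  constructor
  · rintro ⟨hw, i, hi, h⟩
    refine ⟨⟨i, hi⟩, mem_simplexFace_of_subset hw (Finset.erase_subset _ _) fun j hj hj' => ?_⟩
    have : j = i := by simpa [hj] using hj'
    rwa [this]
  · rintro ⟨⟨i, hi⟩, hw⟩
    exact ⟨simplexFace_mono (Finset.erase_subset _ _) hw, i, hi, hw.2.1 i (by simp)⟩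

open Classical in
/-- The support of a finitely supported function as a finset (junk value `∅` otherwise). -/
noncomputable def vertexSupport (w : V → ℝ) : Finset V :=
  if h : (Function.support w).Finite then h.toFinset else ∅

theorem mem_vertexSupport (hw : w ∈ simplexFace σ) {i : V} : i ∈ vertexSupport w ↔ w i ≠ 0 := by
  have h : (Function.support w).Finite :=
    σ.finite_toSet.subset fun i hi => by_contra fun hiσ => hi (hw.2.1 i hiσ)
  rw [vertexSupport, dif_pos h, h.mem_toFinset, Function.mem_support]

theorem vertexSupport_subset (hw : w ∈ simplexFace σ) : vertexSupport w ⊆ σ := fun i hi =>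
  by_contra fun hiσ => (mem_vertexSupport hw).1 hi (hw.2.1 i hiσ)

theorem mem_simplexFace_vertexSupport (hw : w ∈ simplexFace σ) :
    w ∈ simplexFace (vertexSupport w) :=
  mem_simplexFace_of_subset hw (vertexSupport_subset hw) fun i _ hi => by
    simpa [mem_vertexSupport hw] using hi

variable {E : Type*} [NormedAddCommGroup E] [NormedSpace ℝ E] {U : Set E}

/-- `g` maps all faces of dimension less than `n` continuously into `U`, and it is affine, with
vertices `c`, on those faces for which this is possible. -/
def IsSimplexMap (U : Set E) (c : V → E) (n : ℕ) (g : (V → ℝ) → E) : Prop :=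
  ∀ σ : Finset V, σ.card ≤ n → ContinuousOn g (simplexFace σ) ∧ MapsTo g (simplexFace σ) U ∧
    (convexHull ℝ (c '' σ) ⊆ U → EqOn g (fun w => ∑ i ∈ σ, w i • c i) (simplexFace σ))

theorem IsSimplexMap.exists_succ {c : V → E} (hc : ∀ i, c i ∈ U)
    (hext : ∀ σ : Finset V, 2 ≤ σ.card → ∀ u : (V → ℝ) → E, ContinuousOn u (simplexBoundary σ) →
      MapsTo u (simplexBoundary σ) U → ExtendsTo u (simplexBoundary σ) (simplexFace σ) U)
    {n : ℕ} {g : (V → ℝ) → E} (hg : IsSimplexMap U c n g) :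
    ∃ g', IsSimplexMap U c (n + 1) g' ∧
      ∀ σ : Finset V, σ.card ≤ n → EqOn g' g (simplexFace σ) := by
  classical
  have key : ∀ σ : Finset V, ∃ v : (V → ℝ) → E, σ.card = n + 1 →
      ContinuousOn v (simplexFace σ) ∧ MapsTo v (simplexFace σ) U ∧
      EqOn v g (simplexBoundary σ) ∧
      (convexHull ℝ (c '' σ) ⊆ U → EqOn v (fun w => ∑ i ∈ σ, w i • c i) (simplexFace σ)) := by
    intro σ
    by_cases hσ : σ.card = n + 1
    swap
    · exact ⟨g, fun h => absurd h hσ⟩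
    have hcard : ∀ i : σ, (σ.erase i).card ≤ n := fun i => by
      rw [Finset.card_erase_of_mem i.2, hσ]; rfl
    by_cases hgood : convexHull ℝ (c '' σ) ⊆ U
    · refine ⟨fun w => ∑ i ∈ σ, w i • c i, fun _ => ⟨by fun_prop, ?_, ?_, fun _ _ _ => rfl⟩⟩
      · rintro w ⟨hw, -, hw1⟩
        exact hgood ((convex_convexHull ℝ _).sum_mem (fun i _ => hw i) hw1
          fun i hi => subset_convexHull ℝ _ (mem_image_of_mem c hi))
      · intro w hw
        rw [simplexBoundary_eq_iUnion, mem_iUnion] at hw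
        obtain ⟨i, hi⟩ := hw
        have hsub : c '' (σ.erase i : Finset V) ⊆ c '' σ :=
          image_mono (by simp)
        rw [(hg _ (hcard i)).2.2 ((convexHull_mono hsub).trans hgood) hi]
        exact (Finset.sum_subset (Finset.erase_subset _ _) fun j _ hj => by
          rw [hi.2.1 j hj, zero_smul]).symm
    · have h2 : 2 ≤ σ.card := by
        by_contra hlt
        obtain ⟨a, rfl⟩ := Finset.card_eq_one.1 (by omega : σ.card = 1)
        exact hgood (by simpa using hc a)
      have hgc : ContinuousOn g (simplexBoundary σ) := by
        rw [simplexBoundary_eq_iUnion]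
        exact (locallyFinite_of_finite _).continuousOn_iUnion (fun _ => isClosed_simplexFace)
          fun i => (hg _ (hcard i)).1
      have hgU : MapsTo g (simplexBoundary σ) U := by
        rw [simplexBoundary_eq_iUnion]
        exact mapsTo_iUnion.2 fun i => (hg _ (hcard i)).2.1
      obtain ⟨v, hv, hvU, hvg⟩ := hext σ h2 g hgc hgU
      exact ⟨v, fun _ => ⟨hv, hvU, hvg, fun h => absurd h hgood⟩⟩
  choose v hv using key
  set g' : (V → ℝ) → E := fun w =>
    if (vertexSupport w).card = n + 1 then v (vertexSupport w) w else g w with hg'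
  have hg'g : ∀ σ : Finset V, σ.card ≤ n → EqOn g' g (simplexFace σ) := by
    intro σ hσ w hw
    refine if_neg fun h => ?_
    have := Finset.card_le_card (vertexSupport_subset hw)
    omega
  refine ⟨g', fun σ hσ => ?_, hg'g⟩
  rcases Nat.lt_or_ge n σ.card with hlt | hle
  · have hσ' : σ.card = n + 1 := by omega
    obtain ⟨h1, h2, h3, h4⟩ := hv σ hσ'
    have heq : EqOn g' (v σ) (simplexFace σ) := by
      intro w hw
      have hsub := vertexSupport_subset hw
      by_cases hs : vertexSupport w = σ
      · simp only [hg', hs, hσ', if_true]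
      · have hlt := Finset.card_lt_card (hsub.ssubset_of_ne hs)
        obtain ⟨i, hi, hi'⟩ := Finset.exists_of_ssubset (hsub.ssubset_of_ne hs)
        have hb : w ∈ simplexBoundary σ :=
          ⟨hw, i, hi, by simpa [mem_vertexSupport hw] using hi'⟩
        rw [h3 hb]
        exact if_neg (by omega)
    exact ⟨h1.congr heq, fun w hw => heq hw ▸ h2 hw, fun h => heq.trans (h4 h)⟩
  · obtain ⟨h1, h2, h3⟩ := hg σ hle
    have heq := hg'g σ hle
    exact ⟨h1.congr heq, fun w hw => heq hw ▸ h2 hw, fun h => heq.trans (h3 h)⟩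

theorem exists_isSimplexMap {c : V → E} (hc : ∀ i, c i ∈ U)
    (hext : ∀ σ : Finset V, 2 ≤ σ.card → ∀ u : (V → ℝ) → E, ContinuousOn u (simplexBoundary σ) →
      MapsTo u (simplexBoundary σ) U → ExtendsTo u (simplexBoundary σ) (simplexFace σ) U) :
    ∃ g, ∀ n, IsSimplexMap U c n g := by
  have h0 : IsSimplexMap U c 0 0 := by
    intro σ hσ
    obtain rfl : σ = ∅ := by simpa using hσ
    have : simplexFace (∅ : Finset V) = ∅ := by simp [simplexFace]
    simp [this, mapsTo_empty]
  choose! next hnext hagree using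
    fun (n : ℕ) (g : (V → ℝ) → E) (hg : IsSimplexMap U c n g) => hg.exists_succ hc hext
  let G : ℕ → (V → ℝ) → E := fun n => Nat.rec 0 next n
  have hG : ∀ n, IsSimplexMap U c n (G n) := fun n => by
    induction n with
    | zero => exact h0
    | succ n ih => exact hnext n _ ih
  have hGm : ∀ (σ : Finset V) (m : ℕ), σ.card ≤ m →
      EqOn (G m) (G σ.card) (simplexFace σ) := by
    intro σ m hm
    induction m, hm using Nat.le_induction with
    | base => exact fun _ _ => rfl
    | succ m hm ih => exact (hagree m _ (hG m) σ hm).trans ih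
  set g : (V → ℝ) → E := fun w => G (vertexSupport w).card w with hg
  have hgG : ∀ σ : Finset V, EqOn g (G σ.card) (simplexFace σ) := fun σ w hw =>
    (hGm _ _ (Finset.card_le_card (vertexSupport_subset hw))
      (mem_simplexFace_vertexSupport hw)).symm
  refine ⟨g, fun n σ _ => ?_⟩
  obtain ⟨h1, h2, h3⟩ := hG σ.card σ le_rfl
  exact ⟨h1.congr (hgG σ), fun w hw => hgG σ hw ▸ h2 hw, fun h => (hgG σ).trans (h3 h)⟩

/-- An open set is contractible if all maps from boundaries of simplices to it extend. -/
theorem contractibleSpace_of_extendsTo_simplexFace (hU : IsOpen U) (hne : U.Nonempty)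
    (hext : ∀ σ : Finset U, 2 ≤ σ.card → ∀ u : (U → ℝ) → E, ContinuousOn u (simplexBoundary σ) →
      MapsTo u (simplexBoundary σ) U → ExtendsTo u (simplexBoundary σ) (simplexFace σ) U) :
    ContractibleSpace U := by
  classical
  obtain ⟨g, hg⟩ := exists_isSimplexMap (c := ((↑) : U → E)) (fun i => i.2) hext
  have hgc : ∀ σ : Finset U, ContinuousOn g (simplexFace σ) := fun σ => (hg _ σ le_rfl).1
  have hgU : ∀ σ : Finset U, MapsTo g (simplexFace σ) U := fun σ => (hg _ σ le_rfl).2.1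
  have hgaff : ∀ σ : Finset U, convexHull ℝ (((↑) : U → E) '' σ) ⊆ U →
      EqOn g (fun w => ∑ i ∈ σ, w i • (i : E)) (simplexFace σ) := fun σ => (hg _ σ le_rfl).2.2
  have hradius : ∀ i : U, ∃ s : ℝ, 0 < s ∧ Metric.ball (i : E) (2 * s) ⊆ U := fun i => by
    obtain ⟨s, hs, hsU⟩ := Metric.isOpen_iff.1 hU i i.2
    exact ⟨s / 2, half_pos hs, by rwa [mul_div_cancel₀ _ two_ne_zero]⟩
  choose r hr using hradius
  obtain ⟨ρ, hρ⟩ := PartitionOfUnity.exists_isSubordinate isClosed_univ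
    (fun i : U => Metric.ball i (r i)) (fun i => Metric.isOpen_ball)
    (fun i _ => mem_iUnion.2 ⟨i, Metric.mem_ball_self (hr i).1⟩)
  have hball : ∀ x i, ρ i x ≠ 0 → dist x i < r i := fun x i hi =>
    hρ i (subset_tsupport _ hi)
  have hface : ∀ x, (fun i => ρ i x) ∈ simplexFace (ρ.finsupport x) := fun x =>
    ⟨fun i => ρ.nonneg i x, fun i hi => by simpa [ρ.mem_finsupport] using hi,
      ρ.sum_finsupport (mem_univ x)⟩
  have hconv : ∀ x : U, ∃ B ⊆ U, Convex ℝ B ∧ (x : E) ∈ B ∧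
      ((↑) : U → E) '' (ρ.finsupport x) ⊆ B := by
    intro x
    have hne : (ρ.finsupport x).Nonempty := by
      obtain ⟨i, hi⟩ := ρ.exists_pos (mem_univ x)
      exact ⟨i, (ρ.mem_finsupport x).2 hi.ne'⟩
    obtain ⟨m, hm, hmax⟩ := Finset.exists_max_image _ r hne
    have hxm := hball x m ((ρ.mem_finsupport x).1 hm)
    refine ⟨_, (hr m).2, convex_ball _ _, ?_, ?_⟩
    · exact Metric.mem_ball.2 (lt_of_lt_of_le hxm (by linarith [(hr m).1]))
    · rintro _ ⟨i, hi, rfl⟩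
      have hxi := hball x i ((ρ.mem_finsupport x).1 hi)
      have := hmax i hi
      refine Metric.mem_ball.2 (lt_of_le_of_lt (dist_triangle_left (i : E) m x) ?_)
      change dist x i + dist x m < _
      linarith
  obtain ⟨a, haU⟩ := hne
  set e : U → ℝ := Pi.single ⟨a, haU⟩ 1 with he
  set W : U × unitInterval → U → ℝ := fun p i => (1 - (p.2 : ℝ)) * ρ i p.1 + p.2 * e i with hW
  have hWc : Continuous W := by fun_prop
  have hWface : ∀ (x : U) (t : unitInterval) (σ : Finset U), ρ.finsupport x ⊆ σ →
      W (x, t) ∈ simplexFace (insert ⟨a, haU⟩ σ) := by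
    intro x t σ hσ
    obtain ⟨h1, h2, h3⟩ := simplexFace_mono (hσ.trans (Finset.subset_insert ⟨a, haU⟩ σ)) (hface x)
    have he0 : ∀ i, 0 ≤ e i := fun i => by
      by_cases h : i = ⟨a, haU⟩ <;> simp [he, h]
    refine ⟨fun i => ?_, fun i hi => ?_, ?_⟩
    · exact add_nonneg (mul_nonneg (sub_nonneg.2 t.2.2) (h1 i)) (mul_nonneg t.2.1 (he0 i))
    · have : e i = 0 :=
        Pi.single_eq_of_ne (fun h => hi (by rw [h]; exact Finset.mem_insert_self _ _)) _
      simp only [hW]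
      rw [show ρ i x = 0 from h2 i hi, this, mul_zero, mul_zero, add_zero]
    · have : ∑ i ∈ insert ⟨a, haU⟩ σ, e i = 1 := by simp [he]
      simp only [hW, Finset.sum_add_distrib, ← Finset.mul_sum, this, h3]
      ring
  have hgW : Continuous (g ∘ W) := by
    refine continuous_iff_continuousAt.2 fun ⟨x, t⟩ => ?_
    have hev : ∀ᶠ p : U × unitInterval in 𝓝 (x, t),
        W p ∈ simplexFace (insert ⟨a, haU⟩ (ρ.fintsupport x)) := by
      have := (continuous_fst.tendsto (x, t)).eventually (ρ.eventually_finsupport_subset x)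
      filter_upwards [this] with p hp
      exact hWface p.1 p.2 _ hp
    exact (hgc _ _ hev.self_of_nhds).tendsto.comp
      (tendsto_nhdsWithin_iff.2 ⟨hWc.tendsto _, hev⟩)
  have hgWU : ∀ p, g (W p) ∈ U := fun p => hgU _ (hWface p.1 p.2 _ subset_rfl)
  let Φ : C(U × unitInterval, U) := ⟨fun p => ⟨g (W p), hgWU p⟩, hgW.subtype_mk _⟩
  have hW0 : ∀ x, W (x, 0) = fun i => ρ i x := fun x => by simp [hW]
  have hW1 : ∀ x, W (x, 1) = e := fun x => by simp [hW]
  let φ : C(U, U) := Φ.comp ⟨fun x => (x, 0), by fun_prop⟩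
  have hline : ∀ (x : U) (t : unitInterval), AffineMap.lineMap (x : E) (φ x : E) (t : ℝ) ∈ U := by
    intro x t
    obtain ⟨B, hBU, hB, hxB, hσB⟩ := hconv x
    refine hBU (hB.lineMap_mem hxB ?_ t.2)
    change g (W (x, 0)) ∈ B
    rw [hW0, hgaff _ ((convexHull_min hσB hB).trans hBU) (hface x)]
    exact hB.sum_mem (fun i _ => ρ.nonneg i x) (hface x).2.2
      fun i hi => hσB (mem_image_of_mem _ hi)
  rw [contractible_iff_id_nullhomotopic]
  refine ⟨Φ (⟨a, haU⟩, 1), ContinuousMap.Homotopic.trans (g := φ) ⟨⟨⟨fun p =>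
    ⟨AffineMap.lineMap (p.2 : E) (φ p.2 : E) (p.1 : ℝ), hline p.2 p.1⟩, ?_⟩, ?_, ?_⟩⟩
    ⟨⟨Φ.comp ⟨fun p => (p.2, p.1), by fun_prop⟩, ?_, ?_⟩⟩⟩
  · simp only [AffineMap.lineMap_apply_module]
    fun_prop
  · intro x
    exact Subtype.ext (by simp)
  · intro x
    exact Subtype.ext (by simp)
  · intro x
    rfl
  · intro x
    refine Subtype.ext ?_
    change g (W (x, 1)) = g (W (⟨a, haU⟩, 1))
    rw [hW1, hW1]

end SimplexMap

/-- If `U ⊆ ℂⁿ` is a bounded connected open set with smooth boundary admitting a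
holomorphic map `f : U → U` with `f(U)` contained in a compact subset of `U` and inducing
isomorphisms `f_* : π_k(U, z) → π_k(U, f(z))` for all `k ≥ 1`, then `U` is contractible. -/
theorem contractible_of_holomorphic_contraction {n : ℕ}
    (U : Set (EuclideanSpace ℂ (Fin n)))
    (hUo : IsOpen U) (hUc : IsConnected U) (hUb : Bornology.IsBounded U)
    (hUsb : HasSmoothBoundary U)
    (f : EuclideanSpace ℂ (Fin n) → EuclideanSpace ℂ (Fin n))
    (hf : DifferentiableOn ℂ f U) (hmaps : Set.MapsTo f U U)
    (K : Set (EuclideanSpace ℂ (Fin n))) (hK : IsCompact K) (hKU : K ⊆ U) (hfK : f '' U ⊆ K)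
    (F : C(U, U)) (hF : ∀ z : U, (F z : EuclideanSpace ℂ (Fin n)) = f z)
    (x : U)
    (hiso : ∀ k : ℕ, 1 ≤ k → Function.Bijective (inducedPi F (Fin k) x)) :
    ContractibleSpace U := by
  have hUp : IsPathConnected U := hUo.isConnected_iff_isPathConnected.1 hUc
  have hfK' : Set.MapsTo f U K := Set.mapsTo_iff_image_subset.2 hfK
  have hshrink : ∀ C ⊆ U, IsCompact C →
      ∃ m, ∃ B ⊆ U, Convex ℝ B ∧ B.Nonempty ∧ Set.MapsTo f^[m] C B := by
    intro C hCU hC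
    obtain ⟨r, hr, hrU⟩ := hK.exists_thickening_subset_open hUo hKU
    obtain ⟨m, hm, hm1⟩ := ((eventually_dist_iterate_lt hUo hUc.isPreconnected hUb hf hK hKU hfK'
      hC hCU x.2 hr).and (Filter.eventually_ge_atTop 1)).exists
    obtain ⟨m, rfl⟩ := Nat.exists_eq_add_of_le' hm1
    have hmK : f^[m + 1] x ∈ K := by
      rw [Function.iterate_succ_apply']
      exact hfK' (hmaps.iterate m x.2)
    refine ⟨m + 1, Metric.ball (f^[m + 1] x) r, fun y hy => hrU ?_, convex_ball _ _,
      ⟨_, Metric.mem_ball_self hr⟩, fun y hy => ?_⟩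
    · exact Metric.mem_thickening_iff.2 ⟨_, hmK, hy⟩
    · rw [Metric.mem_ball, dist_comm]
      exact hm y hy
  refine contractibleSpace_of_extendsTo_simplexFace hUo ⟨x, x.2⟩ fun σ hσ u hu huU => ?_
  obtain ⟨k, hk⟩ := Nat.exists_eq_add_of_le' hσ
  refine extendsTo_simplexFace (k := k) (fun v hv hvU => ?_) hk hu huU
  cases k with
  | zero => exact extendsTo_of_isPathConnected hUp hvU
  | succ k =>
    exact extendsTo_of_iterate hUo hUp hf.continuousOn hmaps hF
      (hiso (k + 1) (by omega)).1 hshrink hv hvU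
end
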